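/- arXiv:1704.03523 — 3 statements merged into one kernel-verified Lean document; each statement's English description precedes it below -/
import Mathlib

section
/- Every finite group whose order is of the form p^a * q^b, for primes p, q and natural numbers a, b, is solvable (Burnside's theorem). -/
/-- Equality in the triangle inequality for complex numbers of norm one. -/
theorem eq_of_norm_sum_eq_card {ι : Type*} [Fintype ι] (f : ι → ℂ) (hf : ∀ i, ‖f i‖ = 1)
    (h : ‖∑ i, f i‖ = Fintype.card ι) : ∃ c, ∀ i, f i = c := by
  rcases isEmpty_or_nonempty ι with hι | hι
  · exact ⟨0, fun i => hι.elim i⟩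
  have hd : (0 : ℝ) < Fintype.card ι := by exact_mod_cast Fintype.card_pos
  set S := ∑ i, f i with hS
  set d : ℝ := (Fintype.card ι : ℝ) with hd'
  have hsum : ∑ i, (d - (f i * (starRingEnd ℂ) S).re) = 0 := by
    rw [Finset.sum_sub_distrib, ← Complex.re_sum, ← Finset.sum_mul, ← hS, Complex.mul_conj,
      Complex.normSq_eq_norm_sq, h]
    simp only [Finset.sum_const, Finset.card_univ, nsmul_eq_mul, Complex.ofReal_re]
    ring
  have hle : ∀ i, (f i * (starRingEnd ℂ) S).re ≤ d := fun i => by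
    refine (Complex.re_le_norm _).trans ?_
    rw [norm_mul, hf, Complex.norm_conj, h, one_mul]
  have heq := (Finset.sum_eq_zero_iff_of_nonneg fun i _ => sub_nonneg.2 (hle i)).1 hsum
  refine ⟨S / d, fun i => ?_⟩
  have h1 : (f i * (starRingEnd ℂ) S).re = d := by linarith [heq i (Finset.mem_univ i)]
  have h2 : ‖f i * (starRingEnd ℂ) S‖ = d := by
    rw [norm_mul, hf, Complex.norm_conj, h, one_mul]
  have h3 : f i * (starRingEnd ℂ) S = d := by
    have him : (f i * (starRingEnd ℂ) S).im = 0 := by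
      have := Complex.sq_norm_sub_sq_re (f i * (starRingEnd ℂ) S)
      rw [h1, h2, sub_self] at this
      exact pow_eq_zero_iff two_ne_zero |>.1 this.symm
    exact Complex.ext (by simpa using h1) (by simpa using him)
  have h5 : S * (starRingEnd ℂ) S = d * d := by
    rw [Complex.mul_conj, Complex.normSq_eq_norm_sq, h]; push_cast; ring
  have hdc : (d : ℂ) ≠ 0 := by exact_mod_cast hd.ne'
  have h6 : (starRingEnd ℂ) S ≠ 0 := by
    intro h0; rw [h0, mul_zero] at h5; exact hdc (mul_self_eq_zero.1 h5.symm)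
  apply mul_right_cancel₀ h6
  rw [h3, div_mul_eq_mul_div, h5]; field_simp

open IntermediateField in
/-- If the average of a family of roots of unity is an algebraic integer, then either it vanishes
or all members of the family are equal. -/
theorem sum_eq_zero_or_eq_of_isIntegral {ι : Type*} [Fintype ι] (f : ι → ℂ) {n : ℕ} (hn : 0 < n)
    (hf : ∀ i, f i ^ n = 1) (h : IsIntegral ℤ ((∑ i, f i) / Fintype.card ι)) :
    ∑ i, f i = 0 ∨ ∃ c, ∀ i, f i = c := by
  rw [or_iff_not_imp_left]
  intro h0
  have hd : (Fintype.card ι : ℂ) ≠ 0 := by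
    intro hd
    have : IsEmpty ι := Fintype.card_eq_zero_iff.1 (by exact_mod_cast hd)
    simp at h0
  have hint : ∀ i, IsIntegral ℚ (f i) := fun i =>
    IsIntegral.of_pow hn (by rw [hf]; exact isIntegral_one)
  let K := adjoin ℚ (Set.range f)
  have : FiniteDimensional ℚ K := finiteDimensional_adjoin fun x hx => by
    obtain ⟨i, rfl⟩ := hx; exact hint i
  have : NumberField K := ⟨⟩
  let g : ι → K := fun i => ⟨f i, subset_adjoin ℚ _ ⟨i, rfl⟩⟩
  let x : K := (∑ i, g i) / Fintype.card ι
  have hx : (x : ℂ) = (∑ i, f i) / Fintype.card ι := by simp [x, g]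
  have hroot : ∀ z : ℂ, z ^ n = 1 → ‖z‖ = 1 :=
    fun z hz => Complex.norm_eq_one_of_pow_eq_one hz hn.ne'
  obtain ⟨k, hk, hk'⟩ := NumberField.Embeddings.pow_eq_one_of_norm_le_one K ℂ (x := x)
    (fun hx0 => div_ne_zero h0 hd (by rw [← hx, hx0]; rfl))
    ((isIntegral_algHom_iff (K.val.restrictScalars ℤ) K.val.injective).1 (by simpa [hx] using h))
    (fun φ => by
      have hg : ∀ i, ‖φ (g i)‖ = 1 := fun i => hroot _ (by
        rw [← map_pow, show g i ^ n = 1 from Subtype.ext (hf i), map_one])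
      simp only [x, map_div₀, map_sum, map_natCast, norm_div, Complex.norm_natCast]
      apply div_le_one_of_le₀ _ (by positivity)
      refine (norm_sum_le _ _).trans ?_
      simp [hg])
  apply eq_of_norm_sum_eq_card f fun i => hroot _ (hf i)
  have : ‖(x : ℂ)‖ = 1 := Complex.norm_eq_one_of_pow_eq_one
    (by exact_mod_cast congrArg (Subtype.val) hk') hk.ne'
  rw [hx, norm_div, Complex.norm_natCast] at this
  exact (div_eq_one_iff_eq (by exact_mod_cast hd)).1 this

open Polynomial in
theorem Matrix.eq_scalar_of_roots_charpoly {d : ℕ} (M : Matrix (Fin d) (Fin d) ℂ) {n : ℕ}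
    (hn : 0 < n) (hM : M ^ n = 1) (c : ℂ) (hc : ∀ z ∈ M.charpoly.roots, z = c) :
    M = c • 1 := by
  have hdvd : minpoly ℂ M ∣ X ^ n - 1 := minpoly.dvd _ _ (by simp [hM])
  have hnodup : (minpoly ℂ M).roots.Nodup :=
    nodup_roots (((X_pow_sub_one_separable_iff).2 (by exact_mod_cast hn.ne')).of_dvd hdvd)
  have hle : (minpoly ℂ M).roots ≤ {c} := (Multiset.le_iff_subset hnodup).2 fun z hz =>
    Multiset.mem_singleton.2 (hc z (Multiset.mem_of_le
      (roots.le_of_dvd M.charpoly_monic.ne_zero M.minpoly_dvd_charpoly) hz))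
  have hmonic := minpoly.monic (Algebra.IsIntegral.isIntegral (R := ℂ) M)
  have hX : minpoly ℂ M ∣ X - C c := by
    rw [(IsAlgClosed.splits (minpoly ℂ M)).eq_prod_roots_of_monic hmonic]
    simpa using Multiset.prod_dvd_prod_of_le (Multiset.map_le_map (f := fun a => X - C a) hle)
  have := (minpoly.dvd_iff).1 hX
  simpa [sub_eq_zero, Algebra.algebraMap_eq_smul_one] using this

theorem Matrix.pow_eq_one_of_mem_roots_charpoly {d : ℕ} {M : Matrix (Fin d) (Fin d) ℂ} {n : ℕ}
    (hM : M ^ n = 1) {z : ℂ} (hz : z ∈ M.charpoly.roots) : z ^ n = 1 := by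
  have hz' := spectrum.pow_mem_pow M n
    (Matrix.mem_spectrum_iff_isRoot_charpoly.2 (Polynomial.isRoot_of_mem_roots hz))
  rcases subsingleton_or_nontrivial (Matrix (Fin d) (Fin d) ℂ) with _ | _
  · simp [spectrum.of_subsingleton] at hz'
  · rwa [hM, spectrum.one_eq, Set.mem_singleton_iff] at hz'

theorem Matrix.isIntegral_trace_of_pow_eq_one {d : ℕ} {M : Matrix (Fin d) (Fin d) ℂ} {n : ℕ}
    (hn : 0 < n) (hM : M ^ n = 1) : IsIntegral ℤ M.trace := by
  rw [Matrix.trace_eq_sum_roots_charpoly]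
  refine IsIntegral.multiset_sum fun z hz => IsIntegral.of_pow hn ?_
  rw [pow_eq_one_of_mem_roots_charpoly hM hz]
  exact isIntegral_one

/-- If `M` is a complex matrix of finite order such that the average of its eigenvalues is an
algebraic integer, then `M` has trace zero or is a scalar matrix. -/
theorem Matrix.trace_eq_zero_or_eq_scalar {d : ℕ} (M : Matrix (Fin d) (Fin d) ℂ) {n : ℕ}
    (hn : 0 < n) (hM : M ^ n = 1) (h : IsIntegral ℤ (M.trace / d)) :
    M.trace = 0 ∨ ∃ c : ℂ, M = c • 1 := by
  have hcard : Fintype.card M.charpoly.roots = d := by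
    rw [Multiset.card_coe, IsAlgClosed.card_roots_eq_natDegree]; simp
  have := sum_eq_zero_or_eq_of_isIntegral (fun z : M.charpoly.roots => z.1) hn
    (fun z => pow_eq_one_of_mem_roots_charpoly hM (Multiset.coe_mem))
    (by rwa [← Multiset.sum_eq_sum_coe, ← Matrix.trace_eq_sum_roots_charpoly, hcard])
  rw [← Multiset.sum_eq_sum_coe, ← Matrix.trace_eq_sum_roots_charpoly] at this
  refine this.imp_right fun ⟨c, hc⟩ => ⟨c, M.eq_scalar_of_roots_charpoly hn hM c fun z hz => ?_⟩
  exact hc ⟨z, ⟨0, Multiset.count_pos.2 hz⟩⟩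

theorem trace_mulLeft_of_algEquiv_pi_matrix {A : Type*} [Ring A] [Algebra ℂ A] {n : ℕ}
    {d : Fin n → ℕ} (e : A ≃ₐ[ℂ] Π i, Matrix (Fin (d i)) (Fin (d i)) ℂ) (a : A) :
    LinearMap.trace ℂ A (LinearMap.mulLeft ℂ a) = ∑ i, (d i : ℂ) * (e a i).trace := by
  classical
  let b := (Pi.basis fun i => Matrix.stdBasis ℂ (Fin (d i)) (Fin (d i))).map e.symm.toLinearEquiv
  rw [LinearMap.trace_eq_matrix_trace ℂ b, Matrix.trace, Fintype.sum_sigma]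
  refine Finset.sum_congr rfl fun i _ => ?_
  have key : ∀ j k : Fin (d i),
      (LinearMap.toMatrix b b (LinearMap.mulLeft ℂ a)).diag ⟨i, (j, k)⟩ = e a i j j := by
    intro j k
    rw [Matrix.diag_apply, LinearMap.toMatrix_apply]
    simp only [b, Module.Basis.map_repr, Module.Basis.map_apply, LinearEquiv.trans_apply,
      LinearMap.mulLeft_apply, Pi.basis_repr, Pi.basis_apply]
    have hrepr : ∀ M : Matrix (Fin (d i)) (Fin (d i)) ℂ,
        (Matrix.stdBasis ℂ (Fin (d i)) (Fin (d i))).repr M (j, k) = M j k := fun M => by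
      simp [Matrix.stdBasis]
    rw [hrepr, Matrix.stdBasis_eq_single]
    simp
  rw [Fintype.sum_prod_type]
  simp only [key, Matrix.trace, Finset.mul_sum, Matrix.diag_apply, Finset.sum_const,
    Finset.card_univ, Fintype.card_fin, nsmul_eq_mul]

theorem MonoidAlgebra.trace_mulLeft_single {G : Type*} [Group G] [Fintype G] (g : G)
    [Decidable (g = 1)] :
    LinearMap.trace ℂ (MonoidAlgebra ℂ G) (LinearMap.mulLeft ℂ (MonoidAlgebra.single g 1)) =
      if g = 1 then (Nat.card G : ℂ) else 0 := by
  classical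
  let b : Module.Basis G ℂ (MonoidAlgebra ℂ G) := MonoidAlgebra.basis G ℂ
  have key (h : G) :
      (LinearMap.toMatrix b b (LinearMap.mulLeft ℂ (MonoidAlgebra.single g 1))).diag h =
        if g = 1 then 1 else 0 := by
    rw [Matrix.diag_apply, LinearMap.toMatrix_apply]
    simp [b, MonoidAlgebra.basis]
    rw [Finsupp.single_apply]
    simp
  rw [LinearMap.trace_eq_matrix_trace ℂ b, Matrix.trace]
  simp only [key]
  simp

/-- **Schur's lemma**: central elements of the group algebra act by scalars. -/
theorem MonoidAlgebra.exists_map_eq_scalar {G : Type*} [Group G] {d : ℕ}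
    {φ : MonoidAlgebra ℂ G →ₐ[ℂ] Matrix (Fin d) (Fin d) ℂ} (hφ : Function.Surjective φ)
    {x : MonoidAlgebra ℂ G} (hx : ∀ h : G, Commute (MonoidAlgebra.single h 1) x) :
    ∃ c : ℂ, φ x = c • 1 := by
  have hx' : ∀ y, Commute y x := fun y => by
    induction y using MonoidAlgebra.induction_linear with
    | zero => exact Commute.zero_left x
    | add y z hy hz => exact hy.add_left hz
    | single h r =>
      have : MonoidAlgebra.single h r = r • MonoidAlgebra.single h (1 : ℂ) := by simp
      rw [this]
      exact (hx h).smul_left r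
  obtain ⟨c, hc⟩ := Matrix.mem_range_scalar_iff_commute_single.2 fun i j _ => by
    obtain ⟨y, hy⟩ := hφ (Matrix.single i j 1)
    rw [← hy]
    exact (hx' y).map φ
  exact ⟨c, by rw [← hc, Matrix.scalar_apply, Matrix.smul_one_eq_diagonal]⟩

open Classical in
/-- The central character value of a class sum is an algebraic integer. -/
theorem MonoidAlgebra.exists_isIntegral_card_mul_trace {G : Type*} [Group G] [Fintype G] {d : ℕ}
    [NeZero d] {φ : MonoidAlgebra ℂ G →ₐ[ℂ] Matrix (Fin d) (Fin d) ℂ}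
    (hφ : Function.Surjective φ) (g : G) :
    ∃ ω : ℂ, IsIntegral ℤ ω ∧
      ((Finset.univ.filter (IsConj g)).card : ℂ) * (φ (MonoidAlgebra.single g 1)).trace =
        d * ω := by
  let C (R : Type) [CommRing R] : MonoidAlgebra R G :=
    ∑ h ∈ Finset.univ.filter (IsConj g), MonoidAlgebra.single h 1
  have hcomm : ∀ h : G, Commute (MonoidAlgebra.single h 1) (C ℂ) := fun h => by
    simp only [Commute, SemiconjBy, C, Finset.mul_sum, Finset.sum_mul,
      MonoidAlgebra.single_mul_single, mul_one]
    refine Finset.sum_equiv (MulAut.conj h).toEquiv (fun x => ?_) (fun x _ => by simp)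
    simp only [Finset.mem_filter_univ]
    have hxh : IsConj x (MulAut.conj h x) := isConj_iff.2 ⟨h, rfl⟩
    exact ⟨fun hx => hx.trans hxh, fun hx => hx.trans hxh.symm⟩
  obtain ⟨ω, hω⟩ := exists_map_eq_scalar hφ hcomm
  refine ⟨ω, ?_, ?_⟩
  · have hC : IsIntegral ℤ (C ℂ) := by
      have := map_isIntegral_int (MonoidAlgebra.mapRingHom G (Int.castRingHom ℂ))
        (IsIntegral.of_finite ℤ (C ℤ))
      have hmap : MonoidAlgebra.mapRingHom G (Int.castRingHom ℂ) (C ℤ) = C ℂ := by simp [C]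
      exact hmap ▸ this
    have := map_isIntegral_int φ.toRingHom hC
    rw [AlgHom.toRingHom_eq_coe, RingHom.coe_coe, hω, ← Algebra.algebraMap_eq_smul_one] at this
    exact (isIntegral_algebraMap_iff (algebraMap ℂ (Matrix (Fin d) (Fin d) ℂ)).injective).1 this
  · have h1 : (φ (C ℂ)).trace = d * ω := by
      rw [hω, Matrix.trace_smul, Matrix.trace_one, Fintype.card_fin, smul_eq_mul, mul_comm]
    rw [← h1, map_sum, Matrix.trace_sum, ← nsmul_eq_mul]
    refine (Finset.sum_eq_card_nsmul fun h hh => ?_).symm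
    obtain ⟨c, rfl⟩ := isConj_iff.1 (Finset.mem_filter_univ _ |>.1 hh)
    have : MonoidAlgebra.single (c * g * c⁻¹) (1 : ℂ) = MonoidAlgebra.single c 1 *
        MonoidAlgebra.single g 1 * MonoidAlgebra.single c⁻¹ 1 := by simp
    rw [this, map_mul, Matrix.trace_mul_comm, ← map_mul]
    simp

theorem MonoidAlgebra.map_single_pow_card {G : Type*} [Group G] [Fintype G] {d : ℕ}
    (φ : MonoidAlgebra ℂ G →ₐ[ℂ] Matrix (Fin d) (Fin d) ℂ) (g : G) :
    φ (MonoidAlgebra.single g 1) ^ Fintype.card G = 1 := by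
  rw [← map_pow, MonoidAlgebra.single_pow, pow_card_eq_one, one_pow, ← MonoidAlgebra.one_def,
    map_one]

/-- A representation of a nonabelian simple group in which some nontrivial element acts by a
scalar is trivial. -/
theorem MonoidAlgebra.map_single_eq_one_of_scalar {G : Type*} [Group G] [IsSimpleGroup G]
    (hG : ¬ ∀ x y : G, x * y = y * x) {d : ℕ}
    (φ : MonoidAlgebra ℂ G →ₐ[ℂ] Matrix (Fin d) (Fin d) ℂ) {g : G} (hg : g ≠ 1) {c : ℂ}
    (hc : φ (MonoidAlgebra.single g 1) = c • 1) (h : G) : φ (MonoidAlgebra.single h 1) = 1 := by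
  let f : G →* (Matrix (Fin d) (Fin d) ℂ)ˣ :=
    ((φ : MonoidAlgebra ℂ G →* Matrix (Fin d) (Fin d) ℂ).comp (MonoidAlgebra.of ℂ G)).toHomUnits
  have hf : ∀ x, (f x : Matrix (Fin d) (Fin d) ℂ) = φ (MonoidAlgebra.single x 1) := fun x => rfl
  have hcenter : (Subgroup.center (Matrix (Fin d) (Fin d) ℂ)ˣ).comap f = ⊤ := by
    refine (Subgroup.Normal.eq_bot_or_eq_top inferInstance).resolve_left fun hbot => hg ?_
    rw [← Subgroup.mem_bot, ← hbot, Subgroup.mem_comap, Subgroup.mem_center_iff]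
    intro u
    ext1
    rw [Units.val_mul, Units.val_mul, hf, hc]
    simp
  have hker : f.ker = ⊤ := by
    refine (Subgroup.Normal.eq_bot_or_eq_top inferInstance).resolve_left fun hbot => hG ?_
    intro x y
    apply (MonoidHom.ker_eq_bot_iff f).1 hbot
    rw [map_mul, map_mul]
    have hy : y ∈ (Subgroup.center (Matrix (Fin d) (Fin d) ℂ)ˣ).comap f := hcenter ▸ trivial
    exact Subgroup.mem_center_iff.1 hy (f x)
  have hh : h ∈ f.ker := hker ▸ trivial
  rw [← hf, f.mem_ker.1 hh, Units.val_one]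

/-- The sum of all group elements vanishes in every nontrivial irreducible representation. -/
theorem MonoidAlgebra.map_sum_single_eq_zero {G : Type*} [Group G] [Fintype G] {d : ℕ}
    {φ : MonoidAlgebra ℂ G →ₐ[ℂ] Matrix (Fin d) (Fin d) ℂ} (hφ : Function.Surjective φ)
    (h : ∃ h : G, φ (MonoidAlgebra.single h 1) ≠ 1) :
    φ (∑ x : G, MonoidAlgebra.single x 1) = 0 := by
  have hl : ∀ h : G, MonoidAlgebra.single h (1 : ℂ) * ∑ x : G, MonoidAlgebra.single x 1 =
      ∑ x : G, MonoidAlgebra.single x 1 := fun h => by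
    simp only [Finset.mul_sum, MonoidAlgebra.single_mul_single, mul_one]
    exact Fintype.sum_equiv (Equiv.mulLeft h) _ _ fun x => rfl
  have hr : ∀ h : G, (∑ x : G, MonoidAlgebra.single x 1) * MonoidAlgebra.single h (1 : ℂ) =
      ∑ x : G, MonoidAlgebra.single x 1 := fun h => by
    simp only [Finset.sum_mul, MonoidAlgebra.single_mul_single, mul_one]
    exact Fintype.sum_equiv (Equiv.mulRight h) _ _ fun x => rfl
  obtain ⟨c, hc⟩ := exists_map_eq_scalar hφ fun h => (hl h).trans (hr h).symm
  obtain ⟨h, hh⟩ := h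
  have := congrArg φ (hl h)
  rw [map_mul, hc, mul_smul_comm, mul_one] at this
  rcases eq_or_ne c 0 with rfl | h0
  · rw [hc, zero_smul]
  · exact absurd (smul_right_injective _ h0 this) hh

open Classical in
theorem MonoidAlgebra.dvd_or_trace_eq_zero {G : Type*} [Group G] [Fintype G] [IsSimpleGroup G]
    (hG : ¬ ∀ x y : G, x * y = y * x) {g : G} (hg : g ≠ 1) {p k : ℕ} (hp : p.Prime)
    (hcard : (Finset.univ.filter (IsConj g)).card = p ^ k) {d : ℕ} [NeZero d]
    {φ : MonoidAlgebra ℂ G →ₐ[ℂ] Matrix (Fin d) (Fin d) ℂ} (hφ : Function.Surjective φ)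
    (h : ∃ h : G, φ (MonoidAlgebra.single h 1) ≠ 1) :
    p ∣ d ∨ (φ (MonoidAlgebra.single g 1)).trace = 0 := by
  refine or_iff_not_imp_left.2 fun hpd => ?_
  obtain ⟨ω, hω, hω'⟩ := exists_isIntegral_card_mul_trace hφ g
  have hpow := map_single_pow_card φ g
  have hd : (d : ℂ) ≠ 0 := NeZero.ne _
  have hint : IsIntegral ℤ ((φ (MonoidAlgebra.single g 1)).trace / d) := by
    have hcop : IsCoprime ((p ^ k : ℕ) : ℤ) (d : ℤ) :=
      Nat.isCoprime_iff_coprime.2 (((Nat.Prime.coprime_iff_not_dvd hp).2 hpd).pow_left k)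
    obtain ⟨u, v, huv⟩ := hcop
    have huv' : (u : ℂ) * (p ^ k : ℕ) + v * d = 1 := by exact_mod_cast huv
    have : (φ (MonoidAlgebra.single g 1)).trace / d =
        u * ω + v * (φ (MonoidAlgebra.single g 1)).trace := by
      rw [hcard] at hω'
      field_simp
      linear_combination (-(φ (MonoidAlgebra.single g 1)).trace) * huv' + (u : ℂ) * hω'
    rw [this]
    have hz : ∀ z : ℤ, IsIntegral ℤ (z : ℂ) := fun z => isIntegral_algebraMap
    exact ((hz u).mul hω).add
      ((hz v).mul (Matrix.isIntegral_trace_of_pow_eq_one Fintype.card_pos hpow))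
  refine (Matrix.trace_eq_zero_or_eq_scalar _ Fintype.card_pos hpow hint).resolve_right ?_
  rintro ⟨c, hc⟩
  obtain ⟨x, hx⟩ := h
  exact hx (map_single_eq_one_of_scalar hG φ hg hc x)

theorem Complex.not_isIntegral_inv_prime {p : ℕ} (hp : p.Prime) : ¬ IsIntegral ℤ ((p : ℂ)⁻¹) := by
  intro h
  have h' : IsIntegral ℤ ((p : ℚ)⁻¹) := by
    apply (isIntegral_algebraMap_iff (algebraMap ℚ ℂ).injective).1
    simpa using h
  obtain ⟨z, hz⟩ := IsIntegrallyClosed.isIntegral_iff.1 h'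
  have hp0 : (p : ℚ) ≠ 0 := by exact_mod_cast hp.ne_zero
  have hzp : (p : ℤ) * z = 1 := by
    have : (p : ℚ) * z = 1 := by
      rw [← eq_intCast (algebraMap ℤ ℚ) z, hz, mul_inv_cancel₀ hp0]
    exact_mod_cast this
  exact hp.one_lt.ne' (by exact_mod_cast Int.eq_one_of_mul_eq_one_right (by positivity) hzp)

open Classical in
/-- A finite simple group in which some nontrivial conjugacy class has prime power size is
abelian. -/
theorem IsSimpleGroup.comm_of_card_isConj_eq_prime_pow {G : Type*} [Group G] [Fintype G]
    [IsSimpleGroup G] {g : G} (hg : g ≠ 1) {p k : ℕ} (hp : p.Prime)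
    (hcard : (Finset.univ.filter (IsConj g)).card = p ^ k) (x y : G) : x * y = y * x := by
  by_contra hxy
  have hG : ¬ ∀ x y : G, x * y = y * x := fun h => hxy (h x y)
  obtain ⟨n, d, hd, ⟨e⟩⟩ :=
    IsSemisimpleRing.exists_algEquiv_pi_matrix_of_isAlgClosed ℂ (MonoidAlgebra ℂ G)
  let φ (i : Fin n) : MonoidAlgebra ℂ G →ₐ[ℂ] Matrix (Fin (d i)) (Fin (d i)) ℂ :=
    (Pi.evalAlgHom ℂ _ i).comp e.toAlgHom
  have hφ : ∀ i, Function.Surjective (φ i) := fun i =>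
    (Function.surjective_eval i).comp e.surjective
  let T : Finset (Fin n) := Finset.univ.filter fun i => ∀ h : G, φ i (MonoidAlgebra.single h 1) = 1
  have htrace : ∀ h : G, ∑ i, (d i : ℂ) * (φ i (MonoidAlgebra.single h 1)).trace =
      if h = 1 then (Nat.card G : ℂ) else 0 := fun h => by
    rw [← MonoidAlgebra.trace_mulLeft_single, trace_mulLeft_of_algEquiv_pi_matrix e]
    rfl
  have hT : ∑ i ∈ T, (d i : ℂ) * d i = 1 := by
    have h1 : ∑ i, (d i : ℂ) * (φ i (∑ h : G, MonoidAlgebra.single h 1)).trace = Nat.card G := by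
      simp only [map_sum, Matrix.trace_sum, Finset.mul_sum]
      rw [Finset.sum_comm]
      simp [htrace]
    rw [← Finset.sum_subset (Finset.subset_univ T) fun i _ hi => by
      rw [MonoidAlgebra.map_sum_single_eq_zero (hφ i) (by simpa [T] using hi), Matrix.trace_zero,
        mul_zero]] at h1
    have hc : (Nat.card G : ℂ) ≠ 0 := by exact_mod_cast Nat.card_pos.ne'
    apply mul_right_cancel₀ hc
    rw [one_mul, Finset.sum_mul]
    refine (Finset.sum_congr rfl fun i hi => ?_).trans h1
    have hi' := Finset.mem_filter_univ _ |>.1 hi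
    rw [map_sum, Finset.sum_congr rfl fun h _ => hi' h, Finset.sum_const, Matrix.trace_smul,
      Matrix.trace_one, Fintype.card_fin, Finset.card_univ, nsmul_eq_mul,
      Nat.card_eq_fintype_card]
    ring
  have hsum := htrace g
  rw [if_neg hg, ← Finset.sum_add_sum_compl T,
    Finset.sum_congr rfl fun i (hi : i ∈ T) => by rw [(Finset.mem_filter_univ _ |>.1 hi) g,
      Matrix.trace_one, Fintype.card_fin], hT] at hsum
  have hp0 : (p : ℂ) ≠ 0 := by exact_mod_cast hp.ne_zero
  apply Complex.not_isIntegral_inv_prime hp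
  have : (p : ℂ)⁻¹ = -∑ i ∈ Tᶜ, (d i : ℂ) * (φ i (MonoidAlgebra.single g 1)).trace / p := by
    rw [← Finset.sum_div]
    field_simp
    linear_combination hsum
  rw [this]
  refine (IsIntegral.sum _ fun i hi => ?_).neg
  rcases MonoidAlgebra.dvd_or_trace_eq_zero hG hg hp hcard (hφ i) (by simpa [T] using hi) with
    ⟨m, hm⟩ | h0
  · have hm' : (d i : ℂ) = p * m := by exact_mod_cast hm
    rw [hm', mul_assoc, mul_div_cancel_left₀ _ hp0]
    refine IsIntegral.mul (by exact_mod_cast isIntegral_algebraMap (R := ℤ) (x := (m : ℤ)))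
      (Matrix.isIntegral_trace_of_pow_eq_one Fintype.card_pos
        (MonoidAlgebra.map_single_pow_card (φ i) g))
  · rw [h0, mul_zero, zero_div]
    exact isIntegral_zero

theorem Subgroup.index_centralizer_eq_card_isConj {G : Type*} [Group G] [Fintype G] (g : G)
    [DecidablePred (IsConj g)] :
    (Subgroup.centralizer {g}).index = (Finset.univ.filter (IsConj g)).card := by
  rw [Subgroup.centralizer_eq_comap_stabilizer]
  refine (Subgroup.index_comap_of_surjective _ (f := ConjAct.toConjAct.toMonoidHom)
    ConjAct.toConjAct.surjective).trans ((MulAction.index_stabilizer (ConjAct G) g).trans ?_)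
  rw [← Set.ncard_coe_finset]
  congr 1
  ext x
  rw [ConjAct.mem_orbit_conjAct, Finset.mem_coe, Finset.mem_filter_univ]
  exact isConj_comm

/-- **Burnside's theorem** for simple groups. -/
theorem IsSimpleGroup.isSolvable_of_card_eq {G : Type*} [Group G] [Finite G] [IsSimpleGroup G]
    {p q a b : ℕ} (hp : p.Prime) (hq : q.Prime) (h : Nat.card G = p ^ a * q ^ b) :
    Group.IsSolvable G := by
  classical
  have := Fintype.ofFinite G
  have : Fact p.Prime := ⟨hp⟩
  have : Fact q.Prime := ⟨hq⟩
  by_cases hpG : p ∣ Nat.card G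
  · obtain ⟨P⟩ : Nonempty (Sylow p G) := inferInstance
    have : Nontrivial P := by
      rw [← Finite.one_lt_card_iff_nontrivial]
      rw [P.card_eq_multiplicity]
      exact Nat.one_lt_pow (hp.factorization_pos_of_dvd Nat.card_pos.ne' hpG).ne' hp.one_lt
    have := P.2.center_nontrivial
    obtain ⟨z, hz⟩ := exists_ne (1 : Subgroup.center P)
    have hle : (P : Subgroup G) ≤ Subgroup.centralizer {(z : G)} := by
      intro x hx
      rw [Subgroup.mem_centralizer_singleton_iff]
      exact congrArg Subtype.val (Subgroup.mem_center_iff.1 z.2 ⟨x, hx⟩)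
    have hindex : (Subgroup.centralizer {(z : G)}).index ∣ q ^ b := by
      refine (Subgroup.index_dvd_of_le hle).trans ?_
      refine Nat.Coprime.dvd_of_dvd_mul_left (m := p ^ a) ?_ ?_
      · exact (((Nat.Prime.coprime_iff_not_dvd hp).2 P.not_dvd_index).pow_left a).symm
      · exact h ▸ (P : Subgroup G).index_dvd_card
    obtain ⟨k, -, hk⟩ := (Nat.dvd_prime_pow hq).1 hindex
    rw [Subgroup.index_centralizer_eq_card_isConj] at hk
    have hz1 : (z : G) ≠ 1 := fun hz1 => hz (Subtype.ext (Subtype.ext hz1))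
    exact IsSimpleGroup.comm_iff_isSolvable.1
      (IsSimpleGroup.comm_of_card_isConj_eq_prime_pow hz1 hq (by convert hk))
  · have hdvd : Nat.card G ∣ q ^ b := by
      refine Nat.Coprime.dvd_of_dvd_mul_left (m := p ^ a) ?_ h.dvd
      exact (((Nat.Prime.coprime_iff_not_dvd hp).2 hpG).pow_left a).symm
    obtain ⟨k, -, hk⟩ := (Nat.dvd_prime_pow hq).1 hdvd
    have := (IsPGroup.of_card hk).isNilpotent
    infer_instance

theorem Nat.exists_eq_pow_mul_pow_of_dvd {p q a b n : ℕ} (hp : p.Prime) (hq : q.Prime)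
    (h : n ∣ p ^ a * q ^ b) : ∃ c d, n = p ^ c * q ^ d := by
  obtain ⟨x, y, hx, hy, rfl⟩ := exists_dvd_and_dvd_of_dvd_mul h
  obtain ⟨c, -, rfl⟩ := (Nat.dvd_prime_pow hp).1 hx
  obtain ⟨d, -, rfl⟩ := (Nat.dvd_prime_pow hq).1 hy
  exact ⟨c, d, rfl⟩

theorem stmt_2 (G : Type) [Group G] [Finite G] (p q a b : ℕ)
    (hp : p.Prime) (hq : q.Prime) (h : Nat.card G = p ^ a * q ^ b) :
    IsSolvable G := by
  induction hn : Nat.card G using Nat.strong_induction_on generalizing G a b with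
  | _ n ih =>
    subst hn
    rcases subsingleton_or_nontrivial G with _ | _
    · exact Group.isSolvable_of_comm fun x y => Subsingleton.elim _ _
    by_cases hs : ∀ N : Subgroup G, N.Normal → N = ⊥ ∨ N = ⊤
    · have : IsSimpleGroup G := ⟨hs⟩
      exact IsSimpleGroup.isSolvable_of_card_eq hp hq h
    · push Not at hs
      obtain ⟨N, hN, hbot, htop⟩ := hs
      obtain ⟨c, d, hcd⟩ := Nat.exists_eq_pow_mul_pow_of_dvd hp hq (h ▸ N.card_subgroup_dvd_card)
      obtain ⟨c', d', hcd'⟩ := Nat.exists_eq_pow_mul_pow_of_dvd hp hq (h ▸ N.card_quotient_dvd_card)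
      have h1 : 1 < Nat.card N := N.one_lt_card_iff_ne_bot.2 hbot
      have h2 : Nat.card N < Nat.card G :=
        N.card_le_card_group.lt_of_ne fun hcard => htop (N.card_eq_iff_eq_top.1 hcard)
      have h3 : Nat.card (G ⧸ N) < Nat.card G := by
        rw [N.card_eq_card_quotient_mul_card_subgroup]
        exact lt_mul_of_one_lt_right Nat.card_pos h1
      exact (Group.isSolvable_iff_subgroup_quotient N).2
        ⟨ih _ h2 N c d hcd rfl, ih _ h3 (G ⧸ N) c' d' hcd' rfl⟩
end

section
/- Let p, q be primes and let G be a finite group such that for every prime r dividing |G| with r ≠ p and r ≠ q, G has a normal abelian Sylow r-subgroup. Then G is solvable. -/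
theorem Multiset.eq_of_norm_sum_eq_card {s : Multiset ℂ} (hs : ∀ x ∈ s, ‖x‖ = 1)
    (h : ‖s.sum‖ = s.card) : ∀ x ∈ s, ∀ y ∈ s, x = y := by
  induction s using Multiset.induction_on with
  | empty => simp
  | cons a s ih =>
    have ha : ‖a‖ = 1 := hs a (by simp)
    have hs' : ∀ x ∈ s, ‖x‖ = 1 := fun x hx ↦ hs x (by simp [hx])
    have hle : ‖s.sum‖ ≤ s.card := by
      refine (norm_multiset_sum_le s).trans ?_
      rw [Multiset.map_congr rfl hs']
      simp
    have htri := norm_add_le a s.sum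
    simp only [Multiset.sum_cons, Multiset.card_cons, Nat.cast_add, Nat.cast_one] at h
    have hsum : ‖s.sum‖ = s.card := by linarith
    have heq := ih hs' hsum
    have hray : SameRay ℝ a s.sum := sameRay_iff_norm_add.2 (by linarith)
    have key : ∀ x ∈ s, x = a := by
      intro x hx
      have hrep : s = Multiset.replicate s.card x :=
        Multiset.eq_replicate_card.2 fun y hy ↦ heq y hy x hx
      have hsx : s.sum = (s.card : ℝ) • x := by
        conv_lhs => rw [hrep]
        simp
      have hpos : (0 : ℝ) < s.card := by
        exact_mod_cast Multiset.card_pos_iff_exists_mem.2 ⟨x, hx⟩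
      rw [hsx] at hray
      have hr : SameRay ℝ a x := by
        have := hray.pos_smul_right (inv_pos.2 hpos)
        rwa [smul_smul, inv_mul_cancel₀ hpos.ne', one_smul] at this
      exact ((sameRay_iff_of_norm_eq (by rw [ha, hs' x hx])).1 hr).symm
    intro x hx y hy
    rw [Multiset.mem_cons] at hx hy
    rcases hx with rfl | hx <;> rcases hy with rfl | hy
    · rfl
    · exact (key y hy).symm
    · exact key x hx
    · exact heq x hx y hy

theorem Multiset.sum_eq_zero_or_eq_of_isIntegral_sum_div_card {s : Multiset ℂ} {m : ℕ}
    (hm : 0 < m) (hs : ∀ x ∈ s, x ^ m = 1) (hint : IsIntegral ℤ (s.sum / s.card)) :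
    s.sum = 0 ∨ ∀ x ∈ s, ∀ y ∈ s, x = y := by
  rw [or_iff_not_imp_left]
  intro h0
  have hcard : (s.card : ℂ) ≠ 0 := by
    intro hc
    rw [Nat.cast_eq_zero, Multiset.card_eq_zero] at hc
    simp [hc] at h0
  let K := IntermediateField.adjoin ℚ {x : ℂ | x ∈ s}
  have : Finite {x : ℂ | x ∈ s} := s.finite_toSet
  have : FiniteDimensional ℚ K := by
    refine IntermediateField.finiteDimensional_adjoin fun x hx ↦ ?_
    exact IsIntegral.of_pow hm (by rw [hs x hx]; exact isIntegral_one)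
  have : NumberField K := { }
  lift s to Multiset K using fun x hx ↦ IntermediateField.subset_adjoin ℚ _ hx with t ht
  have hsum : (t.map (fun x : K ↦ (x : ℂ))).sum = ((t.sum : K) : ℂ) :=
    (map_multiset_sum (algebraMap K ℂ) t).symm
  rw [Multiset.card_map] at hint hcard
  rw [hsum] at h0 hint
  have hroot : ∀ x ∈ t, x ^ m = 1 := fun x hx ↦ by
    have := hs x (Multiset.mem_map_of_mem _ hx)
    exact_mod_cast this
  have hnorm : ∀ φ : K →+* ℂ, ∀ x ∈ t.map φ, ‖x‖ = 1 := by
    intro φ x hx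
    obtain ⟨y, hy, rfl⟩ := Multiset.mem_map.1 hx
    exact Complex.norm_eq_one_of_pow_eq_one (by rw [← map_pow, hroot y hy, map_one]) hm.ne'
  have hcard' : (0 : ℝ) < t.card := by
    have : t.card ≠ 0 := by exact_mod_cast hcard
    positivity
  obtain ⟨n, hn, hpow⟩ := NumberField.Embeddings.pow_eq_one_of_norm_le_one
    (x := t.sum / (t.card : K)) K ℂ
    (div_ne_zero (by exact_mod_cast h0) (by exact_mod_cast hcard))
    ((isIntegral_algebraMap_iff (algebraMap K ℂ).injective).1 (by simpa using hint))
    (fun φ ↦ by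
      rw [map_div₀, map_natCast, map_multiset_sum, norm_div, Complex.norm_natCast,
        div_le_one hcard']
      refine (norm_multiset_sum_le _).trans ?_
      rw [Multiset.map_congr rfl (hnorm φ)]
      simp)
  refine Multiset.eq_of_norm_sum_eq_card (hnorm (algebraMap K ℂ)) ?_
  have hone := Complex.norm_eq_one_of_pow_eq_one (ζ := ((t.sum / (t.card : K) : K) : ℂ))
    (by exact_mod_cast hpow) hn.ne'
  push_cast at hone
  rw [norm_div, Complex.norm_natCast, div_eq_one_iff_eq hcard'.ne'] at hone
  rw [Multiset.card_map, ← hone]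

open Polynomial in
theorem Matrix.pow_eq_one_of_mem_roots_charpoly_s5 {K n : Type*} [Field K] [Fintype n]
    [DecidableEq n] {A : Matrix n n K} {m : ℕ} (hA : A ^ m = 1) {x : K}
    (hx : x ∈ A.charpoly.roots) : x ^ m = 1 := by
  have h := Matrix.mem_spectrum_of_isRoot_charpoly (isRoot_of_mem_roots hx)
  have hpow := spectrum.pow_mem_pow A m h
  cases subsingleton_or_nontrivial (Matrix n n K)
  · simp at h
  simpa [hA] using hpow

theorem Matrix.isIntegral_trace_of_pow_eq_one_s5 {K n : Type*} [Field K] [IsAlgClosed K]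
    [Fintype n] [DecidableEq n] {A : Matrix n n K} {m : ℕ} (hm : 0 < m) (hA : A ^ m = 1) :
    IsIntegral ℤ A.trace := by
  rw [Matrix.trace_eq_sum_roots_charpoly]
  refine IsIntegral.multiset_sum fun x hx ↦ IsIntegral.of_pow hm ?_
  rw [Matrix.pow_eq_one_of_mem_roots_charpoly_s5 hA hx]
  exact isIntegral_one

open Polynomial in
theorem Matrix.trace_eq_zero_or_eq_scalar_of_isIntegral {n : Type*} [Fintype n] [DecidableEq n]
    {A : Matrix n n ℂ} {m : ℕ} (hm : 0 < m) (hA : A ^ m = 1)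
    (hint : IsIntegral ℤ (A.trace / Fintype.card n)) :
    A.trace = 0 ∨ ∃ z : ℂ, A = algebraMap ℂ _ z := by
  have hcard : A.charpoly.roots.card = Fintype.card n := by
    rw [IsAlgClosed.card_roots_eq_natDegree, Matrix.charpoly_natDegree_eq_dim]
  have htr := Matrix.trace_eq_sum_roots_charpoly A
  rw [htr]
  refine (Multiset.sum_eq_zero_or_eq_of_isIntegral_sum_div_card hm
    (fun x hx ↦ Matrix.pow_eq_one_of_mem_roots_charpoly_s5 hA hx)
    (by rwa [hcard, ← htr])).imp_right fun h ↦ ?_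
  cases isEmpty_or_nonempty n
  · exact ⟨0, Subsingleton.elim _ _⟩
  obtain ⟨z, hz⟩ := Multiset.card_pos_iff_exists_mem.1 (hcard ▸ Fintype.card_pos (α := n))
  have hchar : A.charpoly = (X - C z) ^ Fintype.card n := by
    rw [(IsAlgClosed.splits A.charpoly).eq_prod_roots_of_monic A.charpoly_monic,
      Multiset.eq_replicate_card.2 fun y hy ↦ h y hy z hz, hcard]
    simp
  have hsq : Squarefree (minpoly ℂ A) := by
    refine Squarefree.squarefree_of_dvd (minpoly.dvd ℂ A (p := X ^ m - 1) (by simp [hA])) ?_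
    exact (separable_X_pow_sub_C (1 : ℂ) (by exact_mod_cast hm.ne') one_ne_zero).squarefree
  have hdvd : minpoly ℂ A ∣ X - C z := by
    have h' := hchar ▸ A.minpoly_dvd_charpoly
    exact (hsq.dvd_pow_iff_dvd Fintype.card_ne_zero).1 h'
  refine ⟨z, ?_⟩
  have := aeval_eq_zero_of_dvd_aeval_eq_zero hdvd (minpoly.aeval ℂ A)
  simpa [sub_eq_zero] using this

theorem LinearMap.trace_mulLeft_pi_matrix {K ι : Type*} [Field K] [Fintype ι] {n : ι → Type*}
    [∀ i, Fintype (n i)] (M : ∀ i, Matrix (n i) (n i) K) :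
    LinearMap.trace K _ (LinearMap.mulLeft K M) = ∑ i, Fintype.card (n i) * (M i).trace := by
  classical
  rw [LinearMap.trace_eq_matrix_trace K (Pi.basis fun i ↦ Matrix.stdBasis K (n i) (n i)),
    Matrix.trace, Fintype.sum_sigma]
  refine Finset.sum_congr rfl fun i _ ↦ ?_
  rw [Fintype.sum_prod_type, Matrix.trace, Finset.mul_sum]
  refine Finset.sum_congr rfl fun a _ ↦ ?_
  have (b : n i) : (LinearMap.toMatrix (Pi.basis fun i ↦ Matrix.stdBasis K (n i) (n i))
      (Pi.basis fun i ↦ Matrix.stdBasis K (n i) (n i)) (LinearMap.mulLeft K M)).diag ⟨i, a, b⟩ =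
      M i a a := by
    rw [Matrix.diag_apply, LinearMap.toMatrix_apply, Pi.basis_repr, Pi.basis_apply,
      LinearMap.mulLeft_apply, Pi.mul_apply, Pi.single_eq_same]
    simp [Matrix.stdBasis, Matrix.ofLinearEquiv, Matrix.mul_apply]
    rw [Finset.sum_eq_single a] <;> simp +contextual
  rw [Finset.sum_congr rfl fun b _ ↦ this b]
  simp

theorem MonoidAlgebra.trace_mulLeft_of {K G : Type*} [Field K] [Group G] [Finite G] {g : G}
    (hg : g ≠ 1) : LinearMap.trace K _ (LinearMap.mulLeft K (MonoidAlgebra.of K G g)) = 0 := by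
  classical
  have := Fintype.ofFinite G
  rw [LinearMap.trace_eq_matrix_trace K (MonoidAlgebra.basis G K), Matrix.trace]
  refine Finset.sum_eq_zero fun x _ ↦ ?_
  rw [Matrix.diag_apply, LinearMap.toMatrix_apply]
  simp [MonoidAlgebra.single_mul_single, MonoidAlgebra.basis, hg]

namespace MonoidAlgebra

variable {G n : Type*} [Group G] [Fintype n] [DecidableEq n]
  {f : MonoidAlgebra ℂ G →ₐ[ℂ] Matrix n n ℂ}

theorem exists_map_eq_algebraMap_of_commute (hf : Function.Surjective f)
    {a : MonoidAlgebra ℂ G} (ha : ∀ x : G, Commute (of ℂ G x) a) :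
    ∃ c : ℂ, f a = algebraMap ℂ _ c := by
  have hcomm (b : MonoidAlgebra ℂ G) : Commute b a := by
    induction b using MonoidAlgebra.induction_on with
    | of x => exact ha x
    | add x y hx hy => exact hx.add_left hy
    | smul r x hx => exact hx.smul_left r
  have hmem : f a ∈ Set.range (Matrix.scalar n) := by
    rw [Matrix.mem_range_scalar_iff_commute_single']
    intro i j
    obtain ⟨b, hb⟩ := hf (Matrix.single i j 1)
    rw [← hb]
    exact (hcomm b).map f
  obtain ⟨c, hc⟩ := hmem
  exact ⟨c, hc.symm⟩

theorem isIntegral_ncard_conjugatesOf_mul_trace_div_card [Finite G] [Nonempty n]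
    (hf : Function.Surjective f) (g : G) :
    IsIntegral ℤ ((conjugatesOf g).ncard * (f (of ℂ G g)).trace / Fintype.card n) := by
  classical
  have := Fintype.ofFinite G
  let C : Finset G := {x | x ∈ conjugatesOf g}
  have hC : (conjugatesOf g).ncard = C.card := by
    rw [Set.ncard_eq_toFinset_card']
    congr 1
    ext; simp [C]
  have hmem (x) : x ∈ C ↔ IsConj g x := by simp [C, conjugatesOf]
  obtain ⟨c, hc⟩ := exists_map_eq_algebraMap_of_commute hf (a := ∑ x ∈ C, of ℂ G x) (fun y ↦ by
    rw [commute_iff_eq, Finset.mul_sum, Finset.sum_mul]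
    refine Finset.sum_bij (fun x _ ↦ y * x * y⁻¹) ?_ (by simp) ?_ ?_
    · intro x hx
      rw [hmem] at hx ⊢
      exact hx.trans (isConj_iff.2 ⟨y, rfl⟩)
    · intro x hx
      rw [hmem] at hx
      exact ⟨y⁻¹ * x * y, (hmem _).2 <| hx.trans (isConj_iff.2 ⟨y⁻¹, by group⟩), by group⟩
    · intro x hx
      rw [← map_mul, ← map_mul]
      simp)
  have hcint : IsIntegral ℤ c := by
    let φ := MonoidAlgebra.lift ℤ (Matrix n n ℂ) G
      ((f : MonoidAlgebra ℂ G →* Matrix n n ℂ).comp (of ℂ G))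
    have h1 : φ (∑ x ∈ C, of ℤ G x) = algebraMap ℂ _ c := by
      rw [← hc, map_sum, map_sum]
      exact Finset.sum_congr rfl fun x _ ↦ by simp [φ]
    have h2 : IsIntegral ℤ (∑ x ∈ C, of ℤ G x) := IsIntegral.of_finite ℤ _
    have h3 := h2.map φ
    rw [h1] at h3
    exact (isIntegral_algebraMap_iff (algebraMap ℂ (Matrix n n ℂ)).injective).1 h3
  convert hcint
  rw [div_eq_iff (by simp)]
  have htr := congrArg Matrix.trace hc
  rw [map_sum, Matrix.trace_sum, Finset.sum_congr rfl (g := fun _ ↦ (f (of ℂ G g)).trace)] at htr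
  · rw [hC]
    simpa [Matrix.algebraMap_eq_diagonal, Matrix.trace_diagonal, mul_comm] using htr
  · intro x hx
    rw [hmem] at hx
    obtain ⟨y, rfl⟩ := isConj_iff.1 hx
    rw [map_mul, map_mul, Matrix.trace_mul_comm, ← map_mul, ← map_mul]
    simp

theorem trace_eq_zero_or_eq_algebraMap_of_coprime [Finite G] [Nonempty n]
    (hf : Function.Surjective f) (g : G)
    (hco : (conjugatesOf g).ncard.Coprime (Fintype.card n)) :
    (f (of ℂ G g)).trace = 0 ∨ ∃ z : ℂ, f (of ℂ G g) = algebraMap ℂ _ z := by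
  have hpow : f (of ℂ G g) ^ orderOf g = 1 := by
    rw [← map_pow, ← map_pow, pow_orderOf_eq_one, map_one, map_one]
  refine Matrix.trace_eq_zero_or_eq_scalar_of_isIntegral (orderOf_pos g) hpow ?_
  obtain ⟨a, b, hab⟩ := Nat.isCoprime_iff_coprime.2 hco
  have hn : (Fintype.card n : ℂ) ≠ 0 := by simp
  have hab' : (a * (conjugatesOf g).ncard + b * Fintype.card n : ℂ) = 1 := by exact_mod_cast hab
  have h1 : (f (of ℂ G g)).trace / Fintype.card n =
      a * ((conjugatesOf g).ncard * (f (of ℂ G g)).trace / Fintype.card n) +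
      b * (f (of ℂ G g)).trace := by
    field_simp
    linear_combination -(f (of ℂ G g)).trace * hab'
  rw [h1]
  have (k : ℤ) : IsIntegral ℤ (k : ℂ) := isIntegral_algebraMap (x := k)
  exact ((this a).mul (isIntegral_ncard_conjugatesOf_mul_trace_div_card hf g)).add
    ((this b).mul (Matrix.isIntegral_trace_of_pow_eq_one_s5 (orderOf_pos g) hpow))
theorem map_eq_one_of_prime_pow_ncard_conjugatesOf [Finite G] [IsSimpleGroup G] [Nonempty n]
    (hf : Function.Surjective f) {g : G} (hg : g ∉ Subgroup.center G) {p k : ℕ} (hp : p.Prime)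
    (hcard : (conjugatesOf g).ncard = p ^ k) (hn : ¬ p ∣ Fintype.card n)
    (htr : (f (of ℂ G g)).trace ≠ 0) (x : G) : f (of ℂ G x) = 1 := by
  obtain ⟨z, hz⟩ := (trace_eq_zero_or_eq_algebraMap_of_coprime hf g (by
    rw [hcard]
    exact Nat.Coprime.pow_left k ((Nat.Prime.coprime_iff_not_dvd hp).2 hn))).resolve_left htr
  let ρ : G →* Matrix n n ℂ := (f : MonoidAlgebra ℂ G →* Matrix n n ℂ).comp (of ℂ G)
  rcases ρ.normal_ker.eq_bot_or_eq_top with h | h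
  · refine absurd (Subgroup.mem_center_iff.2 fun y ↦ ?_) hg
    have hcomm : (y * g) * (g * y)⁻¹ ∈ ρ.ker := by
      rw [MonoidHom.mem_ker]
      have h1 : ρ (y * g) = ρ (g * y) := by
        rw [map_mul, map_mul, show ρ g = algebraMap ℂ _ z from hz]
        exact (Algebra.commutes z (ρ y)).symm
      rw [map_mul, h1, ← map_mul, mul_inv_cancel, map_one]
    rw [h, Subgroup.mem_bot] at hcomm
    exact mul_inv_eq_one.1 hcomm
  · have : x ∈ ρ.ker := h ▸ Subgroup.mem_top x
    exact this

theorem algHom_eq_algebraMap_of_map_of_eq_one {A : Type*} [Ring A] [Algebra ℂ A]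
    {φ : MonoidAlgebra ℂ G →ₐ[ℂ] A} (h : ∀ x, φ (of ℂ G x) = 1) (a : MonoidAlgebra ℂ G) :
    φ a = algebraMap ℂ A (MonoidAlgebra.lift ℂ ℂ G 1 a) := by
  have : φ = (Algebra.ofId ℂ A).comp (MonoidAlgebra.lift ℂ ℂ G 1) := by
    ext x
    simpa using h x
  exact DFunLike.congr_fun this a

end MonoidAlgebra

theorem Nat.Prime.one_add_mul_ne_zero_of_isIntegral {p : ℕ} (hp : p.Prime) {x : ℂ}
    (hx : IsIntegral ℤ x) : 1 + p * x ≠ 0 := by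
  intro h
  have hp0 : (p : ℂ) ≠ 0 := by exact_mod_cast hp.ne_zero
  have hp0' : (p : ℚ) ≠ 0 := by exact_mod_cast hp.ne_zero
  have hxq : x = algebraMap ℚ ℂ (-1 / p) := by
    simp only [eq_ratCast]
    push_cast
    field_simp
    linear_combination h
  rw [hxq, isIntegral_algebraMap_iff (algebraMap ℚ ℂ).injective,
    IsIntegrallyClosed.isIntegral_iff] at hx
  obtain ⟨y, hy⟩ := hx
  rw [eq_div_iff hp0'] at hy
  have hy' : y * p = -1 := by
    rw [eq_intCast] at hy
    exact_mod_cast hy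
  have : (p : ℤ) ∣ 1 := ⟨-y, by linarith⟩
  exact hp.one_lt.ne' (by exact_mod_cast Int.eq_one_of_dvd_one (by positivity) this)

open MonoidAlgebra in
theorem IsSimpleGroup.mem_center_of_ncard_conjugatesOf_eq_prime_pow {G : Type*} [Group G]
    [Finite G] [IsSimpleGroup G] {g : G} {p k : ℕ} (hp : p.Prime)
    (hcard : (conjugatesOf g).ncard = p ^ k) : g ∈ Subgroup.center G := by
  by_contra hg
  have := Fintype.ofFinite G
  have : NeZero (Nat.card G : ℂ) := ⟨by exact_mod_cast Nat.card_pos.ne'⟩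
  obtain ⟨N, d, hd, ⟨e⟩⟩ :=
    IsSemisimpleRing.exists_algEquiv_pi_matrix_of_isAlgClosed ℂ (MonoidAlgebra ℂ G)
  let f (i : Fin N) : MonoidAlgebra ℂ G →ₐ[ℂ] Matrix (Fin (d i)) (Fin (d i)) ℂ :=
    (Pi.evalAlgHom ℂ _ i).comp e.toAlgHom
  have hf (i) : Function.Surjective (f i) :=
    (Function.surjective_eval i).comp e.surjective
  have htr : ∑ i, (d i : ℂ) * (f i (of ℂ G g)).trace = 0 := by
    have h1 := trace_mulLeft_of (K := ℂ) (g := g) (fun h ↦ hg (h ▸ one_mem _))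
    rw [← LinearMap.trace_conj' _ e.toLinearEquiv] at h1
    have h2 : e.toLinearEquiv.conj (LinearMap.mulLeft ℂ (of ℂ G g)) =
        LinearMap.mulLeft ℂ (e (of ℂ G g)) := by
      refine LinearMap.ext fun x ↦ ?_
      simp [LinearEquiv.conj_apply]
    rw [h2, LinearMap.trace_mulLeft_pi_matrix] at h1
    simpa [f] using h1
  -- the trivial representation occurs
  obtain ⟨i₀, hi₀⟩ : ∃ i, ∀ x, f i (of ℂ G x) = 1 := by
    have hx (x : G) : of ℂ G x * ∑ y, of ℂ G y = ∑ y, of ℂ G y := by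
      rw [Finset.mul_sum]
      exact Fintype.sum_equiv (Equiv.mulLeft x) _ _ fun y ↦ (map_mul _ _ _).symm
    have hx' (x : G) : (∑ y, of ℂ G y) * of ℂ G x = ∑ y, of ℂ G y := by
      rw [Finset.sum_mul]
      exact Fintype.sum_equiv (Equiv.mulRight x) _ _ fun y ↦ (map_mul _ _ _).symm
    have hne : ∑ y, of ℂ G y ≠ 0 := by
      intro h
      have h1 := congrArg (MonoidAlgebra.lift ℂ ℂ G 1) h
      simp at h1
    have hne' : e (∑ y, of ℂ G y) ≠ 0 := 
      (EmbeddingLike.map_ne_zero_iff (f := e)).2 hne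
    obtain ⟨i, hi⟩ := Function.ne_iff.1 hne'
    obtain ⟨c, hc⟩ := exists_map_eq_algebraMap_of_commute (hf i) (a := ∑ y, of ℂ G y)
      fun x ↦ (hx x).trans (hx' x).symm
    refine ⟨i, fun x ↦ ?_⟩
    have hc0 : c ≠ 0 := by
      rintro rfl
      rw [map_zero] at hc
      exact hi hc
    have h1 := congrArg (f i) (hx x)
    rw [map_mul, hc, ← Algebra.commutes, ← Algebra.smul_def, Algebra.algebraMap_eq_smul_one] at h1
    exact smul_right_injective _ hc0 h1
  have hd₀ : d i₀ = 1 := by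
    have hsub : Subsingleton (Fin (d i₀)) := by
      refine ⟨fun a b ↦ by_contra fun hab ↦ ?_⟩
      obtain ⟨u, hu⟩ := hf i₀ (Matrix.single a b 1)
      rw [algHom_eq_algebraMap_of_map_of_eq_one hi₀, Matrix.algebraMap_eq_diagonal] at hu
      have := congrFun (congrFun hu a) b
      simp [hab] at this
    have := Fintype.card_le_one_iff_subsingleton.2 hsub
    have := (hd i₀).ne
    simp only [Fintype.card_fin] at *
    omega
  have huniq (i) (hi : ∀ x, f i (of ℂ G x) = 1) : i = i₀ := by
    by_contra hne
    obtain ⟨u, hu⟩ := e.surjective (Pi.single i 1)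
    have h1 : f i u = 1 := by simp [f, hu]
    have h2 : f i₀ u = 0 := by simp [f, hu, Ne.symm hne]
    rw [algHom_eq_algebraMap_of_map_of_eq_one hi] at h1
    rw [algHom_eq_algebraMap_of_map_of_eq_one hi₀] at h2
    rw [FaithfulSMul.algebraMap_eq_one_iff] at h1
    rw [h1, map_one] at h2
    exact one_ne_zero h2
  have hdiv : ∀ i, ∃ y : ℂ, IsIntegral ℤ y ∧
      (i ≠ i₀ → (d i : ℂ) * (f i (of ℂ G g)).trace = p * y) := by
    intro i
    by_cases hi : i = i₀
    · exact ⟨0, isIntegral_zero, fun h ↦ absurd hi h⟩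
    by_cases ht : (f i (of ℂ G g)).trace = 0
    · exact ⟨0, isIntegral_zero, fun _ ↦ by rw [ht, mul_zero, mul_zero]⟩
    obtain ⟨m, hm⟩ : p ∣ d i := by
      by_contra hpd
      exact hi (huniq i (map_eq_one_of_prime_pow_ncard_conjugatesOf (hf i) hg hp hcard
        (by simpa using hpd) ht))
    refine ⟨m * (f i (of ℂ G g)).trace, .mul ?_ ?_, fun _ ↦ ?_⟩
    · exact isIntegral_algebraMap (x := (m : ℤ))
    · refine Matrix.isIntegral_trace_of_pow_eq_one_s5 (orderOf_pos g) ?_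
      rw [← map_pow, ← map_pow, pow_orderOf_eq_one, map_one, map_one]
    · rw [← mul_assoc, ← Nat.cast_mul, ← hm]
  choose y hy hy' using hdiv
  refine hp.one_add_mul_ne_zero_of_isIntegral
    (IsIntegral.sum y (s := Finset.univ.erase i₀) fun i _ ↦ hy i) ?_
  rw [Finset.mul_sum, ← htr, ← Finset.add_sum_erase _ _ (Finset.mem_univ i₀), hi₀]
  congr 1
  · simp [hd₀]
  · exact Finset.sum_congr rfl fun i hi ↦ (hy' i (Finset.ne_of_mem_erase hi)).symm

theorem Subgroup.card_lt_card_of_ne_top {G : Type*} [Group G] [Finite G] {H : Subgroup G}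
    (h : H ≠ ⊤) : Nat.card H < Nat.card G := by
  rw [← H.card_mul_index]
  exact lt_mul_of_one_lt_right Nat.card_pos (H.one_lt_index_of_ne_top h)

theorem Subgroup.card_quotient_lt_card_of_ne_bot {G : Type*} [Group G] [Finite G]
    {H : Subgroup G} (h : H ≠ ⊥) : Nat.card (G ⧸ H) < Nat.card G := by
  rw [H.card_eq_card_quotient_mul_card_subgroup]
  exact lt_mul_of_one_lt_right Nat.card_pos (H.one_lt_card_iff_ne_bot.2 h)

theorem ncard_conjugatesOf {G : Type*} [Group G] (g : G) :
    (conjugatesOf g).ncard = (Subgroup.centralizer {g}).index := by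
  have h : conjugatesOf g = MulAction.orbit (ConjAct G) g := by
    ext x
    rw [ConjAct.mem_orbit_conjAct]
    exact isConj_comm
  rw [h, ← MulAction.index_stabilizer, Subgroup.centralizer_eq_comap_stabilizer]
  exact (Subgroup.index_comap_of_surjective _ ConjAct.toConjAct.surjective).symm

/-- **Burnside's theorem** for simple groups. -/
theorem IsSimpleGroup.isSolvable_of_forall_prime_dvd {G : Type*} [Group G] [Finite G]
    [IsSimpleGroup G] {p q : ℕ} (hp : p.Prime) (hq : q.Prime)
    (h : ∀ r : ℕ, r.Prime → r ∣ Nat.card G → r = p ∨ r = q) : Group.IsSolvable G := by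
  have := Fact.mk hp
  have := Fact.mk hq
  by_cases hpG : p ∣ Nat.card G
  · let P : Sylow p G := default
    have : Nontrivial P := by
      rw [Subgroup.nontrivial_iff_ne_bot]
      exact P.ne_bot_of_dvd_card hpG
    obtain ⟨⟨z, hz⟩, hz1⟩ := @exists_ne _ P.2.center_nontrivial 1
    have hle : (P : Subgroup G) ≤ Subgroup.centralizer {(z : G)} := by
      intro x hx
      rw [Subgroup.mem_centralizer_singleton_iff]
      exact congrArg Subtype.val (Subgroup.mem_center_iff.1 hz ⟨x, hx⟩)
    have hcard := Nat.eq_prime_pow_of_unique_prime_dvd (p := q)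
      (Subgroup.centralizer {(z : G)}).index_ne_zero_of_finite (fun {r} hr hdvd ↦
        (h r hr (hdvd.trans (Subgroup.index_dvd_card _))).resolve_left (by
          rintro rfl
          exact P.not_dvd_index (hdvd.trans (Subgroup.index_dvd_of_le hle))))
    rw [← ncard_conjugatesOf] at hcard
    have hzc := IsSimpleGroup.mem_center_of_ncard_conjugatesOf_eq_prime_pow hq hcard
    have htop : Subgroup.center G = ⊤ :=
      ((inferInstance : (Subgroup.center G).Normal).eq_bot_or_eq_top).resolve_left fun hbot ↦ by
        rw [hbot, Subgroup.mem_bot] at hzc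
        exact hz1 (Subtype.ext (Subtype.ext hzc))
    exact Group.isSolvable_of_comm fun a b ↦
      (Subgroup.mem_center_iff.1 (htop ▸ Subgroup.mem_top a) b).symm
  · have hq' := Nat.eq_prime_pow_of_unique_prime_dvd (p := q) (Nat.card_pos (α := G)).ne'
      (fun {r} hr hdvd ↦ (h r hr hdvd).resolve_left (by rintro rfl; exact hpG hdvd))
    have := (IsPGroup.of_card hq').isNilpotent
    infer_instance

/-- **Burnside's theorem**: a finite group whose order has at most two prime divisors is
solvable. -/
theorem Group.isSolvable_of_forall_prime_dvd {G : Type*} [Group G] [Finite G] {p q : ℕ}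
    (hp : p.Prime) (hq : q.Prime) (h : ∀ r : ℕ, r.Prime → r ∣ Nat.card G → r = p ∨ r = q) :
    Group.IsSolvable G := by
  induction hn : Nat.card G using Nat.strong_induction_on generalizing G with | _ n ih
  subst hn
  by_cases hN : ∃ N : Subgroup G, N.Normal ∧ N ≠ ⊥ ∧ N ≠ ⊤
  · obtain ⟨N, hNn, hbot, htop⟩ := hN
    have h1 : Group.IsSolvable N := ih _ (Subgroup.card_lt_card_of_ne_top htop)
      (fun r hr hdvd ↦ h r hr (hdvd.trans N.card_subgroup_dvd_card)) rfl
    have h2 : Group.IsSolvable (G ⧸ N) := ih _ (Subgroup.card_quotient_lt_card_of_ne_bot hbot)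
      (fun r hr hdvd ↦ h r hr (hdvd.trans N.card_quotient_dvd_card)) rfl
    exact Group.isSolvable_of_ker_le_range N.subtype (QuotientGroup.mk' N) (by simp)
  · cases subsingleton_or_nontrivial G
    · infer_instance
    · have : IsSimpleGroup G := ⟨fun N hNn ↦ by
        by_contra! hne
        exact hN ⟨N, hNn, hne⟩⟩
      exact IsSimpleGroup.isSolvable_of_forall_prime_dvd hp hq h

theorem Group.isSolvable_of_normal_commutative_sylow {G : Type*} [Group G] [Finite G] {p q : ℕ}
    (hp : p.Prime) (hq : q.Prime)
    (h : ∀ r : ℕ, r.Prime → r ∣ Nat.card G → r ≠ p → r ≠ q →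
      ∃ P : Sylow r G, (P : Subgroup G).Normal ∧ ∀ a b : (P : Subgroup G), a * b = b * a) :
    Group.IsSolvable G := by
  induction hn : Nat.card G using Nat.strong_induction_on generalizing G with | _ n ih
  subst hn
  by_cases hr : ∃ r : ℕ, r.Prime ∧ r ∣ Nat.card G ∧ r ≠ p ∧ r ≠ q
  · obtain ⟨r, hr, hdvd, hrp, hrq⟩ := hr
    have := Fact.mk hr
    obtain ⟨P, hPn, hPc⟩ := h r hr hdvd hrp hrq
    have h1 : Group.IsSolvable P := Group.isSolvable_of_comm hPc
    have h2 : Group.IsSolvable (G ⧸ (P : Subgroup G)) := by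
      refine ih _ (Subgroup.card_quotient_lt_card_of_ne_bot (P.ne_bot_of_dvd_card hdvd)) ?_ rfl
      intro s hs hsdvd hsp hsq
      have := Fact.mk hs
      obtain ⟨Q, hQn, hQc⟩ := h s hs (hsdvd.trans (Subgroup.card_quotient_dvd_card _)) hsp hsq
      have hsurj := QuotientGroup.mk'_surjective (P : Subgroup G)
      refine ⟨Q.mapSurjective hsurj, hQn.map _ hsurj, ?_⟩
      rintro ⟨_, a, ha, rfl⟩ ⟨_, b, hb, rfl⟩
      have hab : a * b = b * a := congrArg Subtype.val (hQc ⟨a, ha⟩ ⟨b, hb⟩)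
      refine Subtype.ext ?_
      rw [Subgroup.coe_mul, Subgroup.coe_mul, ← map_mul, hab, map_mul]
    exact Group.isSolvable_of_ker_le_range (P : Subgroup G).subtype
      (QuotientGroup.mk' (P : Subgroup G)) (by simp)
  · push Not at hr
    exact Group.isSolvable_of_forall_prime_dvd hp hq fun r hrp hdvd ↦
      or_iff_not_imp_left.2 (hr r hrp hdvd)

theorem stmt_5 (G : Type) [Group G] [Finite G] (p q : ℕ) (hp : p.Prime) (hq : q.Prime)
    (h : ∀ r : ℕ, r.Prime → r ∣ Nat.card G → r ≠ p → r ≠ q →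
      ∃ P : Sylow r G, (P : Subgroup G).Normal ∧ ∀ a b : (P : Subgroup G), a * b = b * a) :
    IsSolvable G := by
  exact Group.isSolvable_of_normal_commutative_sylow hp hq h
end

section
/- Let G be a finite group such that every irreducible complex character of G has degree a power of a fixed prime p. Then G is solvable. -/
open CategoryTheory
open Representation Module
open scoped MonoidAlgebra

theorem Module.End.isIntegral_trace_of_pow_eq_one {V : Type*} [AddCommGroup V] [Module ℂ V]
    [FiniteDimensional ℂ V] {f : Module.End ℂ V} {n : ℕ} (hn : n ≠ 0) (hf : f ^ n = 1) :
    IsIntegral ℤ (LinearMap.trace ℂ V f) := by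
  rw [Module.End.trace_eq_sum_roots_charpoly_of_splits (IsAlgClosed.splits _)]
  refine IsIntegral.multiset_sum fun μ hμ ↦ ?_
  obtain ⟨v, hv⟩ := ((Module.End.hasEigenvalue_iff_isRoot_charpoly f μ).2
    (Polynomial.isRoot_of_mem_roots hμ)).exists_hasEigenvector
  have h1 : μ ^ n • v = (1 : ℂ) • v := by rw [← hv.pow_apply, hf, one_smul, Module.End.one_apply]
  exact IsIntegral.of_pow (Nat.pos_of_ne_zero hn)
    (smul_left_injective ℂ hv.2 h1 ▸ isIntegral_one)

theorem Representation.isIntegral_character {G V : Type*} [Group G] [Finite G] [AddCommGroup V]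
    [Module ℂ V] [FiniteDimensional ℂ V] (ρ : Representation ℂ G V) (g : G) :
    IsIntegral ℤ (ρ.character g) :=
  Module.End.isIntegral_trace_of_pow_eq_one Nat.card_pos.ne'
    (by rw [← map_pow, pow_card_eq_one', map_one])

theorem Representation.sum_character_mul_character_inv {G V : Type*} [Group G] [Fintype G]
    [AddCommGroup V] [Module ℂ V] [FiniteDimensional ℂ V] (ρ : Representation ℂ G V)
    [IsIrreducible ρ] : ∑ g : G, ρ.character g * ρ.character g⁻¹ = Nat.card G := by
  have h0 : (Nat.card G : ℂ) ≠ 0 := Nat.cast_ne_zero.2 Nat.card_pos.ne'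
  have := invertibleOfNonzero h0
  have h := char_orthonormal ρ ρ
  rw [if_pos ⟨Representation.Equiv.refl ρ⟩] at h
  rwa [inv_mul_eq_one₀ h0, eq_comm] at h

/-- The degree of an irreducible complex representation of a finite group divides the order of
the group. -/
theorem Representation.IsIrreducible.finrank_dvd_card {G V : Type*} [Group G] [Finite G]
    [AddCommGroup V] [Module ℂ V] [FiniteDimensional ℂ V] (ρ : Representation ℂ G V)
    [IsIrreducible ρ] : finrank ℂ V ∣ Nat.card G := by
  have := Fintype.ofFinite G
  let z : V →ₗ[ℂ] V := ∑ g, ρ.character g⁻¹ • ρ g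
  have hz (h : G) (v : V) : z (ρ h v) = ρ h (z v) := by
    simp only [z, LinearMap.sum_apply, LinearMap.smul_apply, map_sum, map_smul]
    rw [← Equiv.sum_comp (MulAut.conj h).toEquiv]
    refine Finset.sum_congr rfl fun g _ ↦ ?_
    simp only [MulEquiv.toEquiv_eq_coe, MulEquiv.coe_toEquiv, MulAut.conj_apply]
    rw [← Module.End.mul_apply, ← Module.End.mul_apply, ← map_mul, ← map_mul]
    rw [show (h * g * h⁻¹)⁻¹ = h * g⁻¹ * h⁻¹ by group, char_conj, inv_mul_cancel_right]
  obtain ⟨c, hc⟩ := (algebraMap_intertwiningMap_bijective_of_isAlgClosed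
    (ρ := ρ)).2 (z.intertwiningMap_of_isIntertwiningMap ρ ρ hz)
  have hzc (v : V) : z v = c • v := by
    have := congr($hc v)
    simpa [Algebra.algebraMap_eq_smul_one] using this.symm
  have htrace : c * finrank ℂ V = Nat.card G := by
    have h1 : z = c • LinearMap.id := LinearMap.ext hzc
    have h2 := congr(LinearMap.trace ℂ V $h1)
    simp only [z, map_sum, map_smul, LinearMap.trace_id, smul_eq_mul] at h2
    rw [← h2, ← ρ.sum_character_mul_character_inv]
    exact Finset.sum_congr rfl fun g _ ↦ mul_comm _ _
  have : Nontrivial V := IsSimpleModule.nontrivial ℂ[G] ρ.asModule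
  obtain ⟨v, hv⟩ := exists_ne (0 : V)
  have hint : IsIntegral ℤ c := by
    let R := integralClosure ℤ ℂ
    have hcR : IsIntegral R c := by
      refine isIntegral_of_smul_mem_submodule
        (Submodule.span R (Set.range fun g ↦ ρ g v)) ?_
        (Submodule.fg_span (Set.finite_range _)) c fun w hw ↦ ?_
      · rw [Submodule.ne_bot_iff]
        exact ⟨v, Submodule.subset_span ⟨1, by simp⟩, hv⟩
      · induction hw using Submodule.span_induction with
        | mem w hw =>
          obtain ⟨h, rfl⟩ := hw
          rw [← hzc]
          simp only [z, LinearMap.sum_apply, LinearMap.smul_apply]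
          refine Submodule.sum_mem _ fun g _ ↦ ?_
          rw [← Module.End.mul_apply, ← map_mul]
          exact Submodule.smul_mem _ (⟨_, ρ.isIntegral_character g⁻¹⟩ : R)
            (Submodule.subset_span ⟨g * h, rfl⟩)
        | zero => simp
        | add x y _ _ hx hy => rw [smul_add]; exact add_mem hx hy
        | smul r x _ hx => rw [smul_comm]; exact Submodule.smul_mem _ r hx
    exact isIntegral_trans c hcR
  have hd : (finrank ℂ V : ℚ) ≠ 0 := Nat.cast_ne_zero.2 finrank_pos.ne'
  have hd' : (finrank ℂ V : ℂ) ≠ 0 := Nat.cast_ne_zero.2 finrank_pos.ne'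
  have hcq : c = algebraMap ℚ ℂ (Nat.card G / finrank ℂ V) := by
    simp [eq_div_iff hd', htrace]
  rw [hcq, isIntegral_algebraMap_iff (algebraMap ℚ ℂ).injective] at hint
  obtain ⟨m, hm⟩ := IsIntegrallyClosed.isIntegral_iff.1 hint
  rw [eq_div_iff hd] at hm
  refine Int.natCast_dvd_natCast.1 ⟨m, ?_⟩
  rw [mul_comm]
  rw [eq_intCast] at hm
  exact_mod_cast hm.symm


theorem Submodule.dvd_finrank_of_iSup_eq_top {K V ι : Type*} [Field K] [AddCommGroup V]
    [Module K V] [FiniteDimensional K V] {d : ℕ} (s : ι → Submodule K V)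
    (Q : Submodule K V → Prop) (hbot : Q ⊥) (hsup : ∀ t i, Q t → Q (t ⊔ s i))
    (hdisj : ∀ t i, Q t → s i ≤ t ∨ Disjoint t (s i)) (hd : ∀ i, d ∣ finrank K (s i))
    (htop : ⨆ i, s i = ⊤) : d ∣ finrank K V := by
  obtain ⟨t, ⟨hQ, ht⟩, hmax⟩ := wellFounded_gt.has_min
    {t : Submodule K V | Q t ∧ d ∣ finrank K t} ⟨⊥, hbot, by simp⟩
  suffices t = ⊤ by rwa [this, finrank_top] at ht
  rw [← top_le_iff, ← htop, iSup_le_iff]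
  intro i
  refine (hdisj t i hQ).elim id fun h ↦ ?_
  have hrank := Submodule.finrank_sup_add_finrank_inf_eq t (s i)
  rw [h.eq_bot, finrank_bot, add_zero] at hrank
  have := hmax (t ⊔ s i) ⟨hsup t i hQ, hrank ▸ dvd_add ht (hd i)⟩
  by_contra hle
  exact this (left_lt_sup.2 hle)

theorem Representation.isIrreducible_ofModule' {k G M : Type*} [Field k] [Group G]
    [AddCommGroup M] [Module k M] [Module k[G] M] [IsScalarTower k k[G] M]
    [IsSimpleModule k[G] M] : (ofModule' M : Representation k G M).IsIrreducible := by
  rw [irreducible_iff_isSimpleModule_asModule]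
  let ρ : Representation k G M := ofModule' M
  let e : ρ.asModule ≃ₗ[k[G]] M :=
    { ρ.asModuleEquiv with
      map_smul' := fun a x ↦ by
        change ρ.asModuleEquiv (a • x) = a • ρ.asModuleEquiv x
        rw [asModuleEquiv_map_smul]
        simp [ρ, ofModule', asAlgebraHom] }
  exact IsSimpleModule.congr e

theorem Representation.simple_of {G V : Type} [Group G] [Finite G] [AddCommGroup V] [Module ℂ V]
    [FiniteDimensional ℂ V] (ρ : Representation ℂ G V) [IsIrreducible ρ] :
    Simple (FDRep.of ρ) := by
  have := Fintype.ofFinite G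
  exact (FDRep.simple_iff_char_is_norm_one _).2 ρ.sum_character_mul_character_inv

/-- The simple modules of the complex group algebra have dimension a power of `p`. -/
def PrimePowerDegrees (p : ℕ) (G : Type*) [Group G] : Prop :=
  ∀ m : Ideal ℂ[G], m.IsMaximal → ∃ k : ℕ, finrank ℂ (ℂ[G] ⧸ m) = p ^ k

theorem MonoidAlgebra.finrank_eq_card {k G : Type*} [Field k] [Finite G] :
    finrank k k[G] = Nat.card G := by
  have := Fintype.ofFinite G
  simp [(coeffLinearEquiv k).finrank_eq]

theorem PrimePowerDegrees.of_FDRep {G : Type} [Group G] [Finite G] {p : ℕ}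
    (h : ∀ V : FDRep ℂ G, Simple V → ∃ k : ℕ, finrank ℂ V = p ^ k) : PrimePowerDegrees p G := by
  intro m hm
  have := isSimpleModule_iff_isCoatom.2 hm.out
  have : (ofModule' (ℂ[G] ⧸ m) : Representation ℂ G _).IsIrreducible := isIrreducible_ofModule'
  exact h _ (simple_of (ofModule' (ℂ[G] ⧸ m)))

theorem PrimePowerDegrees.exists_finrank_eq {G M : Type*} [Group G] {p : ℕ}
    (h : PrimePowerDegrees p G) [AddCommGroup M] [Module ℂ M] [Module ℂ[G] M]
    [IsScalarTower ℂ ℂ[G] M] [IsSimpleModule ℂ[G] M] : ∃ k : ℕ, finrank ℂ M = p ^ k := by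
  obtain ⟨m, hm, ⟨e⟩⟩ := isSimpleModule_iff_quot_maximal.1 ‹IsSimpleModule ℂ[G] M›
  rw [(e.restrictScalars ℂ).finrank_eq]
  exact h m hm

section Restriction

variable {k G : Type*} [Field k] [Group G] {N : Subgroup G}

/-- The inclusion of the group algebra of a subgroup. -/
noncomputable abbrev MonoidAlgebra.inclusion (k : Type*) [Field k] (N : Subgroup G) :
    k[N] →ₐ[k] k[G] :=
  MonoidAlgebra.mapDomainAlgHom k k N.subtype

theorem MonoidAlgebra.exists_isMaximal_comap_eq [IsSemisimpleRing k[N]] {n : Ideal k[N]}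
    (hn : n.IsMaximal) :
    ∃ m : Ideal k[G], m.IsMaximal ∧ m.comap (inclusion k N) = n := by
  obtain ⟨e, he, rfl⟩ := IsSemisimpleRing.ideal_eq_span_idempotent n
  have hne : Ideal.span {inclusion k N e} ≠ (⊤ : Ideal k[G]) := by
    rw [Ne, Ideal.eq_top_iff_one, Submodule.mem_span_singleton]
    rintro ⟨x, hx⟩
    refine hn.ne_top ((Ideal.eq_top_iff_one _).2 ?_)
    have h1 : inclusion k N e = 1 := by
      calc inclusion k N e = x * inclusion k N e * inclusion k N e := by
            rw [← smul_eq_mul x, hx, one_mul]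
        _ = 1 := by rw [mul_assoc, ← map_mul, he.eq, ← smul_eq_mul x, hx]
    rw [← map_one (inclusion k N)] at h1
    rw [mapDomain_injective Subtype.val_injective h1]
    exact Ideal.mem_span_singleton_self 1
  obtain ⟨m, hm, hle⟩ := Ideal.exists_le_maximal _ hne
  refine ⟨m, hm, (hn.eq_of_le (Ideal.comap_ne_top _ hm.ne_top) ?_).symm⟩
  rw [Ideal.span_singleton_le_iff_mem, Ideal.mem_comap]
  exact hle (Ideal.mem_span_singleton_self _)

/-- A weak form of Clifford's theorem: the dimension of a simple `k[N]`-module occurring in the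
restriction of a simple `k[G]`-module to a normal subgroup `N` divides the dimension of the
latter. -/
theorem MonoidAlgebra.finrank_quotient_comap_dvd [Finite G] [N.Normal] (m : Ideal k[G])
    (hm : (m.comap (inclusion k N)).IsMaximal) :
    finrank k (k[N] ⧸ m.comap (inclusion k N)) ∣ finrank k (k[G] ⧸ m) := by
  set n := m.comap (inclusion k N) with hn
  let f (g : G) : k[N] →ₗ[k] k[G] ⧸ m :=
    (m.mkQ.restrictScalars k) ∘ₗ LinearMap.mulLeft k (of k G g) ∘ₗ (inclusion k N).toLinearMap
  have hf (g : G) (y : k[N]) : f g y = of k G g • m.mkQ (inclusion k N y) := rfl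
  have hker (g : G) : LinearMap.ker (f g) = n.restrictScalars k := by
    ext y
    have : IsUnit (of k G g) := (Group.isUnit g).map _
    rw [LinearMap.mem_ker, hf, this.smul_eq_zero]
    simp [hn]
  have hmul (g : G) (x : N) (y : k[N]) :
      of k G x • f g y = f g (of k N ⟨g⁻¹ * x * g, by
        simpa using Subgroup.Normal.conj_mem ‹_› _ x.2 g⁻¹⟩ * y) := by
    simp only [hf, map_mul]
    rw [← smul_eq_mul (inclusion k N _), map_smul, smul_smul, smul_smul]
    simp [mul_assoc]
  refine Submodule.dvd_finrank_of_iSup_eq_top (fun g ↦ LinearMap.range (f g))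
    (fun t ↦ ∀ x : N, ∀ v ∈ t, of k G x • v ∈ t) ?_ ?_ ?_ ?_ ?_
  · simp
  · intro t g ht x v hv
    obtain ⟨a, ha, _, ⟨y, rfl⟩, rfl⟩ := Submodule.mem_sup.1 hv
    rw [smul_add, hmul]
    exact Submodule.add_mem_sup (ht x a ha) ⟨_, rfl⟩
  · intro t g ht
    let J : Ideal k[N] :=
      { t.comap (f g) with
        smul_mem' := fun a y (hy : f g y ∈ t) ↦ by
          change f g (a * y) ∈ t
          induction a using MonoidAlgebra.induction_on with
          | of x =>
            have hx : x = ⟨g⁻¹ * (g * x * g⁻¹) * g, by simp [mul_assoc]⟩ :=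
              Subtype.ext (by simp [mul_assoc])
            rw [hx, ← hmul g ⟨g * x * g⁻¹, Subgroup.Normal.conj_mem ‹_› _ x.2 g⟩ y]
            exact ht _ _ hy
          | add a b ha hb => rw [add_mul, map_add]; exact add_mem ha hb
          | smul r a ha => rw [smul_mul_assoc, map_smul]; exact t.smul_mem r ha }
    have hnJ : n ≤ J := fun y hy ↦ by
      have : f g y = 0 := by
        rw [← LinearMap.mem_ker, hker]; exact hy
      change f g y ∈ t
      rw [this]
      exact t.zero_mem
    by_cases hJ : J = ⊤
    · left
      rintro _ ⟨y, rfl⟩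
      exact (hJ ▸ Submodule.mem_top : y ∈ J)
    · right
      rw [Submodule.disjoint_def]
      rintro _ hy ⟨y, rfl⟩
      have : y ∈ n := hm.eq_of_le hJ hnJ ▸ hy
      rw [← LinearMap.mem_ker, hker]
      exact this
  · intro g
    rw [← (f g).quotKerEquivRange.finrank_eq, hker,
      (Submodule.Quotient.restrictScalarsEquiv k n).finrank_eq]
  · rw [eq_top_iff]
    rintro v -
    obtain ⟨a, rfl⟩ := m.mkQ_surjective v
    induction a using MonoidAlgebra.induction_on with
    | of g =>
      refine Submodule.mem_iSup_of_mem g ⟨1, ?_⟩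
      rw [hf, map_one, ← map_smul, smul_eq_mul, mul_one]
    | add a b ha hb => rw [map_add]; exact add_mem ha hb
    | smul r a ha => exact Submodule.smul_mem _ r ha

end Restriction

/-- Having irreducible degrees powers of a prime passes to normal subgroups. -/
theorem PrimePowerDegrees.subgroup {G : Type*} [Group G] [Finite G] {p : ℕ} (hp : p.Prime)
    (h : PrimePowerDegrees p G) (N : Subgroup G) [N.Normal] : PrimePowerDegrees p N := by
  intro n hn
  obtain ⟨m, hm, rfl⟩ := MonoidAlgebra.exists_isMaximal_comap_eq hn
  obtain ⟨k, hk⟩ := h m hm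
  have := MonoidAlgebra.finrank_quotient_comap_dvd m hn
  rw [hk, Nat.dvd_prime_pow hp] at this
  exact this.imp fun _ ↦ And.right

/-- A perfect group acts trivially on every one-dimensional module. -/
theorem MonoidAlgebra.of_smul_eq_of_finrank_eq_one {k G M : Type*} [Field k] [Group G]
    (hG : commutator G = ⊤) [AddCommGroup M] [Module k M] [Module k[G] M]
    [IsScalarTower k k[G] M] (hM : finrank k M = 1) (g : G) (v : M) : of k G g • v = v := by
  let ρ : Representation k G M := ofModule' M
  have hker : commutator G ≤ MonoidHom.ker ρ := by
    rw [commutator_def, Subgroup.commutator_le]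
    intro a _ b _
    have hcomm : ρ (a * b) = ρ (b * a) := by
      obtain ⟨c, hc, -⟩ := (ρ a).existsUnique_eq_smul_id_of_finrank_eq_one hM
      rw [map_mul, map_mul, hc]
      ext v
      simp
    rw [MonoidHom.mem_ker, commutatorElement_def, mul_assoc (a * b), map_mul, hcomm, ← map_mul]
    simp
  have : ρ g = 1 := hker (hG ▸ Subgroup.mem_top g)
  simpa [ρ, ofModule'] using congr($this v)

theorem MonoidAlgebra.eq_zero_of_of_mul_eq {k G : Type*} [Field k] [CharZero k] [Group G]
    [Finite G] {a : k[G]} (ha : ∀ g, of k G g * a = a) (ha' : lift k k G 1 a = 0) : a = 0 := by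
  have := Fintype.ofFinite G
  have hcoeff (g : G) : a.coeff g = a.coeff 1 := by
    conv_lhs => rw [← ha g]
    simp [coeff_single_mul_apply]
  rw [lift_apply, Finsupp.sum_fintype _ _ (by simp)] at ha'
  simp [hcoeff] at ha'
  ext g
  rw [hcoeff, ha']
  simp

theorem PrimePowerDegrees.dvd_card_sub_one {G : Type*} [Group G] [Finite G] {p : ℕ}
    (h : PrimePowerDegrees p G) (hG : commutator G = ⊤) : p ∣ Nat.card G - 1 := by
  let ε : ℂ[G] →ₐ[ℂ] ℂ := MonoidAlgebra.lift ℂ ℂ G 1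
  let C : Ideal ℂ[G] := RingHom.ker ε
  have hC : finrank ℂ C = Nat.card G - 1 := by
    have h1 := LinearMap.finrank_range_add_finrank_ker ε.toLinearMap
    have hsurj : LinearMap.range ε.toLinearMap = ⊤ :=
      LinearMap.range_eq_top.2 fun c ↦ ⟨algebraMap ℂ _ c, ε.commutes c⟩
    rw [hsurj, finrank_top, finrank_self, MonoidAlgebra.finrank_eq_card] at h1
    rw [← h1, Nat.add_sub_cancel_left]
    rfl
  rw [← hC]
  refine Submodule.dvd_finrank_of_iSup_eq_top
    (fun s : {s : Submodule ℂ[G] C // IsSimpleModule ℂ[G] s} ↦ s.1.restrictScalars ℂ)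
    (fun t ↦ ∃ t' : Submodule ℂ[G] C, t = t'.restrictScalars ℂ) ⟨⊥, rfl⟩ ?_ ?_ ?_ ?_
  · rintro _ s ⟨t, rfl⟩
    exact ⟨t ⊔ s.1, (Submodule.restrictScalars_sup ..).symm⟩
  · rintro _ ⟨s, hs⟩ ⟨t, rfl⟩
    rcases (isSimpleModule_iff_isAtom.1 hs).le_iff.1 (inf_le_right : t ⊓ s ≤ s) with h0 | h0
    · right
      rw [Submodule.disjoint_def]
      intro v hvt hvs
      have : v ∈ t ⊓ s := ⟨hvt, hvs⟩
      rwa [h0, Submodule.mem_bot] at this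
    · have hst : s ≤ t := inf_eq_right.1 h0
      exact .inl hst
  · rintro ⟨s, hs⟩
    obtain ⟨k, hk⟩ := h.exists_finrank_eq (M := s)
    change p ∣ finrank ℂ s
    rw [hk]
    refine dvd_pow_self _ ?_
    rintro rfl
    have := IsSimpleModule.nontrivial ℂ[G] s
    obtain ⟨v, hv⟩ := exists_ne (0 : s)
    refine hv (Subtype.ext (Subtype.ext ?_))
    refine MonoidAlgebra.eq_zero_of_of_mul_eq (fun g ↦ ?_) v.1.2
    exact congrArg (fun w : s ↦ ((w : C) : ℂ[G]))
      (MonoidAlgebra.of_smul_eq_of_finrank_eq_one hG hk g v)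
  · have htop := IsSemisimpleModule.sSup_simples_eq_top ℂ[G] C
    rw [sSup_eq_iSup'] at htop
    rw [← Submodule.restrictScalars_iSup]
    exact congr(Submodule.restrictScalars ℂ $htop)

/-- A perfect finite group all of whose irreducible degrees are powers of a prime is trivial. -/
theorem PrimePowerDegrees.subsingleton {G : Type*} [Group G] [Finite G] {p : ℕ} (hp : p.Prime)
    (h : PrimePowerDegrees p G) (hG : commutator G = ⊤) : Subsingleton G := by
  have hpG : ¬ p ∣ Nat.card G := fun hdvd ↦ hp.not_dvd_one <| by
    simpa [Nat.sub_sub_self (Nat.card_pos (α := G))] using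
      Nat.dvd_sub hdvd (h.dvd_card_sub_one hG)
  refine subsingleton_of_forall_eq 1 fun g ↦ ?_
  suffices hmem : MonoidAlgebra.of ℂ G g - 1 ∈ Ring.jacobson ℂ[G] by
    rw [IsSemisimpleRing.jacobson_eq_bot, Submodule.mem_bot, sub_eq_zero] at hmem
    exact MonoidAlgebra.of_injective (by rw [hmem, map_one])
  refine Submodule.mem_sInf.2 fun m (hm : IsCoatom m) ↦ ?_
  have := isSimpleModule_iff_isCoatom.2 hm
  have : (ofModule' (ℂ[G] ⧸ m) : Representation ℂ G _).IsIrreducible := isIrreducible_ofModule'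
  have hdvd := IsIrreducible.finrank_dvd_card (ofModule' (ℂ[G] ⧸ m) : Representation ℂ G _)
  obtain ⟨k, hk⟩ := h m ⟨hm⟩
  have hk0 : k = 0 := by
    by_contra hk0
    exact hpG ((dvd_pow_self p hk0).trans (hk ▸ hdvd))
  rw [hk0, pow_zero] at hk
  have := MonoidAlgebra.of_smul_eq_of_finrank_eq_one hG hk g (m.mkQ 1)
  rwa [← map_smul, smul_eq_mul, mul_one, ← sub_eq_zero, ← map_sub, ← LinearMap.mem_ker,
    Submodule.ker_mkQ] at this

theorem PrimePowerDegrees.isSolvable {G : Type*} [Group G] [Finite G] {p : ℕ} (hp : p.Prime)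
    (h : PrimePowerDegrees p G) : Group.IsSolvable G := by
  by_cases hG : commutator G = ⊤
  · have := h.subsingleton hp hG
    infer_instance
  · have : Nat.card (commutator G) < Nat.card G :=
      lt_of_le_of_ne (Subgroup.card_le_card_group _) fun hc ↦ hG (Subgroup.eq_top_of_card_eq _ hc)
    have := PrimePowerDegrees.isSolvable hp (h.subgroup hp (commutator G))
    exact Group.isSolvable_of_ker_le_range (commutator G).subtype (Abelianization.of (G := G))
      (by simp)
termination_by Nat.card G

theorem stmt_7 (G : Type) [Group G] [Finite G] (p : ℕ) (hp : p.Prime)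
    (h : ∀ V : FDRep ℂ G, Simple V → ∃ k : ℕ, Module.finrank ℂ V = p ^ k) :
    IsSolvable G :=
  (PrimePowerDegrees.of_FDRep h).isSolvable hp
end
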